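/- arXiv:1603.00316 — 6 statements merged into one kernel-verified Lean document; each statement's English description precedes it below -/
import Mathlib

section
/- Let D be a finite subset of the unit sphere S^{N-1} in ℝ^N. Then D is a proper quantization if and only if there exists θ ∈ [0, π/2) such that D is a θ-cover. -/
open Real Filter RealInnerProductSpace

noncomputable section

/-- The set of minimizers of `f` over all of `ℝ^N`. -/
def minimizers {N : ℕ} (f : EuclideanSpace ℝ (Fin N) → ℝ) : Set (EuclideanSpace ℝ (Fin N)) :=
  {x | ∀ y, f x ≤ f y}

/-- `D` is a `θ`-cover: every unit vector makes an angle of at most `θ` with some `d ∈ D`. -/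
def IsThetaCover {N : ℕ} (D : Finset (EuclideanSpace ℝ (Fin N))) (θ : ℝ) : Prop :=
  ∀ g : EuclideanSpace ℝ (Fin N), ‖g‖ = 1 → ∃ d ∈ D, Real.cos θ ≤ ⟪g, d⟫

/-- `D` is a proper quantization: for every convex differentiable objective with
`L`-Lipschitz gradient and nonempty bounded set of minimizers, and every starting point,
one can choose directions in `D` and nonnegative step-sizes so that the iterates
`x(t+1) = x(t) - γ(t) • d(t)` converge to the set of minimizers. -/
def ProperQuantization {N : ℕ} (D : Finset (EuclideanSpace ℝ (Fin N))) : Prop :=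
  ∀ f : EuclideanSpace ℝ (Fin N) → ℝ,
    ConvexOn ℝ Set.univ f → Differentiable ℝ f →
    (∃ L : ℝ, 0 < L ∧ ∀ x y, ‖gradient f x - gradient f y‖ ≤ L * ‖x - y‖) →
    (minimizers f).Nonempty → Bornology.IsBounded (minimizers f) →
    ∀ x₀ : EuclideanSpace ℝ (Fin N),
      ∃ (γ : ℕ → ℝ) (d : ℕ → EuclideanSpace ℝ (Fin N)) (x : ℕ → EuclideanSpace ℝ (Fin N)),
        (∀ t, 0 ≤ γ t) ∧ (∀ t, d t ∈ D) ∧ x 0 = x₀ ∧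
        (∀ t, x (t + 1) = x t - γ t • d t) ∧
        Tendsto (fun t => Metric.infDist (x t) (minimizers f)) atTop (nhds 0)

section ProperQuantization

variable {N : ℕ} {D : Finset (EuclideanSpace ℝ (Fin N))}

/-- The covering property of a `θ`-cover, rescaled to vectors of arbitrary norm. -/
lemma IsThetaCover.exists_norm_mul_cos_le {θ : ℝ} (h : IsThetaCover D θ) (hN : 1 ≤ N)
    (v : EuclideanSpace ℝ (Fin N)) : ∃ d ∈ D, ‖v‖ * Real.cos θ ≤ ⟪v, d⟫ := by
  have : Nonempty (Fin N) := ⟨⟨0, hN⟩⟩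
  rcases eq_or_ne v 0 with rfl | hv
  · obtain ⟨g, hg⟩ := exists_norm_eq (EuclideanSpace ℝ (Fin N)) zero_le_one
    obtain ⟨d, hd, -⟩ := h g hg
    exact ⟨d, hd, by simp⟩
  · obtain ⟨d, hd, hle⟩ := h (‖v‖⁻¹ • v) (norm_smul_inv_norm hv)
    refine ⟨d, hd, ?_⟩
    rw [real_inner_smul_left] at hle
    have hpos : 0 < ‖v‖ := norm_pos_iff.2 hv
    calc ‖v‖ * Real.cos θ ≤ ‖v‖ * (‖v‖⁻¹ * ⟪v, d⟫) := by gcongr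
      _ = ⟪v, d⟫ := by field_simp

/-- Subtracting the projection onto a unit vector `d` shrinks the squared norm by `⟪v, d⟫ ^ 2`. -/
lemma norm_sub_inner_smul_sq {E : Type*} [NormedAddCommGroup E] [InnerProductSpace ℝ E]
    (v d : E) (hd : ‖d‖ = 1) : ‖v - ⟪v, d⟫ • d‖ ^ 2 = ‖v‖ ^ 2 - ⟪v, d⟫ ^ 2 := by
  rw [norm_sub_sq_real, real_inner_smul_right, norm_smul, hd, mul_one, Real.norm_eq_abs, sq_abs]
  ring

/-- With the directions of a `θ`-cover, `θ < π / 2`, any point can be reached in the limit. -/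
lemma IsThetaCover.exists_tendsto {θ : ℝ} (h : IsThetaCover D θ) (hN : 1 ≤ N)
    (hD : ∀ d ∈ D, ‖d‖ = 1) (hθ : 0 < Real.cos θ) (x₀ z : EuclideanSpace ℝ (Fin N)) :
    ∃ (γ : ℕ → ℝ) (d : ℕ → EuclideanSpace ℝ (Fin N)) (x : ℕ → EuclideanSpace ℝ (Fin N)),
      (∀ t, 0 ≤ γ t) ∧ (∀ t, d t ∈ D) ∧ x 0 = x₀ ∧
      (∀ t, x (t + 1) = x t - γ t • d t) ∧ Tendsto x atTop (nhds z) := by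
  choose δ hδ hle using h.exists_norm_mul_cos_le hN
  let step (y : EuclideanSpace ℝ (Fin N)) := y - ⟪y - z, δ (y - z)⟫ • δ (y - z)
  let x (t : ℕ) := step^[t] x₀
  have hx (t : ℕ) : x (t + 1) = step (x t) := Function.iterate_succ_apply' step t x₀
  have hnonneg (v : EuclideanSpace ℝ (Fin N)) : 0 ≤ ⟪v, δ v⟫ :=
    (mul_nonneg (norm_nonneg v) hθ.le).trans (hle v)
  refine ⟨fun t => ⟪x t - z, δ (x t - z)⟫, fun t => δ (x t - z), x,
    fun t => hnonneg _, fun t => hδ _, rfl, hx, ?_⟩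
  have hcontract (t : ℕ) : ‖x t - z‖ ^ 2 ≤ (1 - Real.cos θ ^ 2) ^ t * ‖x₀ - z‖ ^ 2 := by
    induction t with
    | zero => simp [x]
    | succ t ih =>
      have hsq : (‖x t - z‖ * Real.cos θ) ^ 2 ≤ ⟪x t - z, δ (x t - z)⟫ ^ 2 :=
        pow_le_pow_left₀ (mul_nonneg (norm_nonneg _) hθ.le) (hle _) 2
      have hstep : x (t + 1) - z = (x t - z) - ⟪x t - z, δ (x t - z)⟫ • δ (x t - z) := by
        rw [hx]; simp only [step]; abel
      have hfac : 0 ≤ 1 - Real.cos θ ^ 2 := by linarith [Real.cos_sq_le_one θ]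
      rw [hstep, norm_sub_inner_smul_sq _ _ (hD _ (hδ _))]
      calc _ ≤ (1 - Real.cos θ ^ 2) * ‖x t - z‖ ^ 2 := by linarith [mul_pow ‖x t - z‖ (cos θ) 2]
        _ ≤ (1 - Real.cos θ ^ 2) * ((1 - Real.cos θ ^ 2) ^ t * ‖x₀ - z‖ ^ 2) := by gcongr
        _ = _ := by ring
  have hsq : Tendsto (fun t => ‖x t - z‖ ^ 2) atTop (nhds 0) := by
    refine squeeze_zero (fun t => sq_nonneg _) hcontract ?_
    have := (tendsto_pow_atTop_nhds_zero_of_lt_one (r := 1 - Real.cos θ ^ 2)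
      (by linarith [Real.cos_sq_le_one θ]) (by linarith [pow_pos hθ 2])).mul_const (‖x₀ - z‖ ^ 2)
    simpa using this
  rw [tendsto_iff_norm_sub_tendsto_zero]
  simpa using hsq.sqrt

lemma IsThetaCover.properQuantization {θ : ℝ} (h : IsThetaCover D θ) (hN : 1 ≤ N)
    (hD : ∀ d ∈ D, ‖d‖ = 1) (hθ : 0 < Real.cos θ) : ProperQuantization D := by
  rintro f - - - ⟨z, hz⟩ - x₀
  obtain ⟨γ, d, x, hγ, hd, hx₀, hx, hlim⟩ := h.exists_tendsto hN hD hθ x₀ z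
  refine ⟨γ, d, x, hγ, hd, hx₀, hx, squeeze_zero (fun t => Metric.infDist_nonneg)
    (fun t => Metric.infDist_le_dist_of_mem hz) (tendsto_iff_dist_tendsto_zero.1 hlim)⟩

lemma hasGradientAt_norm_sq {E : Type*} [NormedAddCommGroup E] [InnerProductSpace ℝ E]
    [CompleteSpace E] (x : E) : HasGradientAt (fun y : E => ‖y‖ ^ 2) ((2 : ℝ) • x) x := by
  rw [hasGradientAt_iff_hasFDerivAt]
  refine (hasStrictFDerivAt_norm_sq x).hasFDerivAt.congr_fderiv ?_
  ext y
  simp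

lemma minimizers_norm_sq :
    minimizers (fun y : EuclideanSpace ℝ (Fin N) => ‖y‖ ^ 2) = {0} := by
  ext x
  simp only [minimizers, Set.mem_ofPred_eq, Set.mem_singleton_iff]
  constructor
  · intro h
    simpa [sq_nonpos_iff] using h 0
  · rintro rfl y
    simp

/-- Testing against `‖·‖ ^ 2` started at `g`: the directions of a proper quantization do not all
lie in a closed half-space `{d | ⟪g, d⟫ ≤ 0}`. -/
lemma ProperQuantization.exists_inner_pos (h : ProperQuantization D)
    {g : EuclideanSpace ℝ (Fin N)} (hg : ‖g‖ = 1) : ∃ d ∈ D, 0 < ⟪g, d⟫ := by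
  by_contra! hneg
  obtain ⟨γ, d, x, hγ, hd, hx₀, hx, hlim⟩ := h (fun y => ‖y‖ ^ 2)
    (convexOn_univ_norm.pow (fun _ _ => norm_nonneg _) 2)
    (fun y => (hasGradientAt_norm_sq y).differentiableAt)
    ⟨2, two_pos, fun y z => by
      rw [(hasGradientAt_norm_sq y).gradient, (hasGradientAt_norm_sq z).gradient, ← smul_sub,
        norm_smul, Real.norm_two]⟩
    (by rw [minimizers_norm_sq]; exact Set.singleton_nonempty 0)
    (by rw [minimizers_norm_sq]; exact Bornology.isBounded_singleton) g
  simp only [minimizers_norm_sq, Metric.infDist_singleton, dist_zero_right] at hlim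
  have hinner (t : ℕ) : 1 ≤ ⟪g, x t⟫ := by
    induction t with
    | zero => simp [hx₀, hg]
    | succ t ih =>
      rw [hx, inner_sub_right, real_inner_smul_right]
      linarith [mul_nonpos_of_nonneg_of_nonpos (hγ t) (hneg _ (hd t))]
  have hnorm (t : ℕ) : 1 ≤ ‖x t‖ := by
    have := real_inner_le_norm g (x t)
    rw [hg, one_mul] at this
    exact (hinner t).trans this
  exact absurd (ge_of_tendsto' hlim hnorm) (by norm_num)

/-- By compactness of the sphere, strict positivity in every direction is uniform. -/
lemma exists_isThetaCover_of_exists_inner_pos (hN : 1 ≤ N) (hD : ∀ d ∈ D, ‖d‖ = 1)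
    (h : ∀ g : EuclideanSpace ℝ (Fin N), ‖g‖ = 1 → ∃ d ∈ D, 0 < ⟪g, d⟫) :
    ∃ θ ∈ Set.Ico 0 (π / 2), IsThetaCover D θ := by
  have : Nonempty (Fin N) := ⟨⟨0, hN⟩⟩
  obtain ⟨u, hu⟩ := exists_norm_eq (EuclideanSpace ℝ (Fin N)) zero_le_one
  have hne : D.Nonempty := (h u hu).imp fun _ hd => hd.1
  have hcont : Continuous fun g : EuclideanSpace ℝ (Fin N) => D.sup' hne fun d => ⟪g, d⟫ :=
    Continuous.finset_sup'_apply hne fun d _ => by fun_prop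
  obtain ⟨g₀, hg₀, hmin⟩ := (isCompact_sphere (0 : EuclideanSpace ℝ (Fin N)) 1).exists_isMinOn
    ⟨u, by simpa using hu⟩ hcont.continuousOn
  rw [mem_sphere_zero_iff_norm] at hg₀
  set m := D.sup' hne fun d => ⟪g₀, d⟫ with hm
  have hm_pos : 0 < m := by
    obtain ⟨d, hd, hpos⟩ := h g₀ hg₀
    exact hpos.trans_le (Finset.le_sup' (fun d => ⟪g₀, d⟫) hd)
  have hm_le : m ≤ 1 := Finset.sup'_le _ _ fun d hd => by
    simpa [hg₀, hD d hd] using real_inner_le_norm g₀ d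
  refine ⟨arccos m, ⟨arccos_nonneg m, arccos_lt_pi_div_two.2 hm_pos⟩, fun g hg => ?_⟩
  rw [Real.cos_arccos (by linarith) hm_le]
  obtain ⟨d, hd, heq⟩ := Finset.exists_mem_eq_sup' hne fun d => ⟪g, d⟫
  exact ⟨d, hd, heq ▸ hmin (mem_sphere_zero_iff_norm.2 hg)⟩

end ProperQuantization

/-- Theorem 1: a finite subset of the unit sphere is a proper quantization
iff it is a `θ`-cover for some `θ ∈ [0, π/2)`. -/
theorem properQuantization_iff_exists_thetaCover {N : ℕ} (hN : 1 ≤ N)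
    (D : Finset (EuclideanSpace ℝ (Fin N))) (hD : ∀ d ∈ D, ‖d‖ = 1) :
    ProperQuantization D ↔ ∃ θ ∈ Set.Ico 0 (π / 2), IsThetaCover D θ := by
  refine ⟨fun h => exists_isThetaCover_of_exists_inner_pos hN hD fun g hg => h.exists_inner_pos hg,
    fun ⟨θ, hθ, h⟩ => h.properQuantization hN hD (Real.cos_pos_of_mem_Ioo ⟨?_, hθ.2⟩)⟩
  linarith [hθ.1, Real.pi_pos]
end
end

section
/- Fix ε > 0 and a constant step-size γ(t) = γ with γ ∈ (0, 2 cos θ · ε / L). Then there exists T ∈ ℕ such that the quantized gradient iterate x(T) satisfies ‖∇f(x(T))‖ ≤ ε, and T is bounded by T ≤ ⌈ 2(f(x(0)) − f*) / ( γ (2 cos θ · ε − L γ) ) ⌉. -/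
open Real Filter RealInnerProductSpace

noncomputable section

/-- The descent lemma: a differentiable function with `L`-Lipschitz gradient lies below its
quadratic upper model at every point. -/
theorem le_add_inner_gradient_add_sq {E : Type*} [NormedAddCommGroup E] [InnerProductSpace ℝ E]
    [CompleteSpace E] {f : E → ℝ} (hdiff : Differentiable ℝ f) {L : ℝ}
    (hLip : ∀ x y, ‖gradient f x - gradient f y‖ ≤ L * ‖x - y‖) (x v : E) :
    f (x + v) ≤ f x + ⟪gradient f x, v⟫ + L / 2 * ‖v‖ ^ 2 := by
  have hderiv (s : ℝ) : HasDerivAt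
      (fun s : ℝ => f (x + s • v) - s * ⟪gradient f x, v⟫ - L / 2 * ‖v‖ ^ 2 * s ^ 2)
      (⟪gradient f (x + s • v), v⟫ - ⟪gradient f x, v⟫ - L * ‖v‖ ^ 2 * s) s := by
    have hline : HasDerivAt (fun s : ℝ => x + s • v) v s := by
      simpa using ((hasDerivAt_id s).smul_const v).const_add x
    have hf := (hdiff (x + s • v)).hasGradientAt.hasFDerivAt.comp_hasDerivAt s hline
    rw [InnerProductSpace.toDual_apply_apply] at hf
    refine ((hf.sub ((hasDerivAt_id s).mul_const ⟪gradient f x, v⟫)).sub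
      ((hasDerivAt_pow 2 s).const_mul (L / 2 * ‖v‖ ^ 2))).congr_deriv ?_
    simp
    ring
  have hanti := antitoneOn_of_deriv_nonpos (convex_Icc (0 : ℝ) 1)
    (fun s _ => (hderiv s).continuousAt.continuousWithinAt)
    (fun s _ => (hderiv s).differentiableAt.differentiableWithinAt) (fun s hs => by
      rw [interior_Icc] at hs
      rw [(hderiv s).deriv, ← inner_sub_left]
      have hgrad := hLip (x + s • v) x
      rw [add_sub_cancel_left, norm_smul, Real.norm_of_nonneg hs.1.le] at hgrad
      have hcs := real_inner_le_norm (gradient f (x + s • v) - gradient f x) v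
      nlinarith [mul_le_mul_of_nonneg_right hgrad (norm_nonneg v)])
  have := hanti (Set.left_mem_Icc.2 zero_le_one) (Set.right_mem_Icc.2 zero_le_one) zero_le_one
  simp only [one_smul, zero_smul, add_zero] at this
  linarith

/-- A sequence bounded below by `m` that drops by at least `c > 0` whenever `P` fails satisfies
`P` at some index at most `⌈(u 0 - m) / c⌉₊`. -/
theorem exists_le_ceil_of_sub_le {u : ℕ → ℝ} {m c : ℝ} {P : ℕ → Prop} (hm : ∀ t, m ≤ u t)
    (hc : 0 < c) (hstep : ∀ t, ¬ P t → u (t + 1) ≤ u t - c) :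
    ∃ T, P T ∧ T ≤ ⌈(u 0 - m) / c⌉₊ := by
  by_contra! h
  have hdrop : ∀ t ≤ ⌈(u 0 - m) / c⌉₊ + 1, u t ≤ u 0 - t * c := by
    intro t ht
    induction t with
    | zero => simp
    | succ t ih =>
      have := hstep t fun hP => absurd (h t hP) (by omega)
      push_cast
      linarith [ih (by omega)]
  have hlast := hdrop _ le_rfl
  have hceil := (div_le_iff₀ hc).1 (Nat.le_ceil ((u 0 - m) / c))
  push_cast at hlast
  linarith [hm (⌈(u 0 - m) / c⌉₊ + 1)]

/-- Theorem 6-a (Type-1 stopping, constant step-size, quantized gradient method):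
if `D` is a `θ`-cover and `γ ∈ (0, 2cosθ·ε/L)` then some iterate `x(T)` satisfies
`‖∇f(x(T))‖ ≤ ε` with `T ≤ ⌈2(f(x(0)) - f*)/(γ(2cosθ·ε - Lγ))⌉`. -/
theorem type1_stopping_quantized {N : ℕ} (hN : 1 ≤ N)
    (f : EuclideanSpace ℝ (Fin N) → ℝ)
    (hconv : ConvexOn ℝ Set.univ f) (hdiff : Differentiable ℝ f)
    (L : ℝ) (hL : 0 < L)
    (hLip : ∀ x y, ‖gradient f x - gradient f y‖ ≤ L * ‖x - y‖)
    (hXne : {x : EuclideanSpace ℝ (Fin N) | ∀ y, f x ≤ f y}.Nonempty)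
    (hXbd : Bornology.IsBounded {x : EuclideanSpace ℝ (Fin N) | ∀ y, f x ≤ f y})
    (fstar : ℝ) (hfstar : IsLeast (Set.range f) fstar)
    (θ : ℝ) (hθ : θ ∈ Set.Ico 0 (π / 2))
    (D : Finset (EuclideanSpace ℝ (Fin N))) (hD : ∀ d ∈ D, ‖d‖ = 1)
    (hcover : ∀ g : EuclideanSpace ℝ (Fin N), ‖g‖ = 1 → ∃ d ∈ D, Real.cos θ ≤ ⟪g, d⟫)
    (ε γ : ℝ) (hε : 0 < ε) (hγ : γ ∈ Set.Ioo 0 (2 * Real.cos θ * ε / L))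
    -- the quantized gradient iterates
    (x d : ℕ → EuclideanSpace ℝ (Fin N))
    (hdD : ∀ t, d t ∈ D)
    (hang : ∀ t, Real.cos θ * ‖gradient f (x t)‖ ≤ ⟪gradient f (x t), d t⟫)
    (hiter : ∀ t, x (t + 1) = x t - γ • d t) :
    ∃ T : ℕ, ‖gradient f (x T)‖ ≤ ε ∧
      T ≤ ⌈2 * (f (x 0) - fstar) / (γ * (2 * Real.cos θ * ε - L * γ))⌉₊ := by
  have hγL : L * γ < 2 * Real.cos θ * ε := by
    have := (lt_div_iff₀ hL).1 hγ.2
    linarith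
  have hcos : 0 ≤ Real.cos θ :=
    Real.cos_nonneg_of_mem_Icc ⟨by linarith [hθ.1, Real.pi_pos], hθ.2.le⟩
  have hc : 0 < γ * (2 * Real.cos θ * ε - L * γ) / 2 :=
    half_pos (mul_pos hγ.1 (sub_pos.2 hγL))
  obtain ⟨T, hT, hle⟩ := exists_le_ceil_of_sub_le (u := fun t => f (x t))
    (P := fun t => ‖gradient f (x t)‖ ≤ ε) (fun t => hfstar.2 ⟨x t, rfl⟩) hc (fun t ht => by
      have hdesc := le_add_inner_gradient_add_sq hdiff hLip (x t) (-(γ • d t))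
      rw [← sub_eq_add_neg, ← hiter, inner_neg_right, real_inner_smul_right, norm_neg, norm_smul,
        hD _ (hdD t), mul_one, Real.norm_eq_abs, sq_abs] at hdesc
      have hinner : Real.cos θ * ε ≤ ⟪gradient f (x t), d t⟫ :=
        (mul_le_mul_of_nonneg_left (not_le.1 ht).le hcos).trans (hang t)
      linarith [mul_le_mul_of_nonneg_left hinner hγ.1.le])
  refine ⟨T, hT, hle.trans_eq ?_⟩
  rw [div_div_eq_mul_div, mul_comm]
end
end

section
/- Fix a constant step-size γ(t) = γ > 0 and a scalar κ > 0, and let ε(κ, γ) = κ + γ L / (2 cos θ). Then there exists T ∈ ℕ such that the quantized gradient iterate x(T) satisfies ‖∇f(x(T))‖ ≤ ε(κ, γ), and T is bounded by T ≤ ⌈ (f(x(0)) − f*) / (cos θ · γ · κ) ⌉. -/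
open Real Filter RealInnerProductSpace

noncomputable section

/-- The descent lemma: a differentiable function with `L`-Lipschitz gradient is bounded above
by its quadratic model at any point. -/
theorem le_add_inner_gradient_add_of_lipschitz_gradient {E : Type*} [NormedAddCommGroup E]
    [InnerProductSpace ℝ E] [CompleteSpace E] {f : E → ℝ} (hf : Differentiable ℝ f) {L : ℝ}
    (hL : ∀ x y, ‖gradient f x - gradient f y‖ ≤ L * ‖x - y‖) (x v : E) :
    f (x + v) ≤ f x + ⟪gradient f x, v⟫ + L / 2 * ‖v‖ ^ 2 := by
  have hφ (s : ℝ) : HasDerivAt (fun s : ℝ => f (x + s • v)) ⟪gradient f (x + s • v), v⟫ s := by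
    have hline : HasDerivAt (fun s : ℝ => x + s • v) v s := by
      simpa using ((hasDerivAt_id s).smul_const v).const_add x
    exact (hf (x + s • v)).hasGradientAt.hasFDerivAt.comp_hasDerivAt s hline
  have hq (s : ℝ) : HasDerivAt
      (fun s : ℝ => f x + s * ⟪gradient f x, v⟫ + s ^ 2 * (L / 2 * ‖v‖ ^ 2))
      (⟪gradient f x, v⟫ + s * (L * ‖v‖ ^ 2)) s := by
    refine ((((hasDerivAt_id s).mul_const ⟪gradient f x, v⟫).const_add (f x)).add
      (((hasDerivAt_id s).pow 2).mul_const (L / 2 * ‖v‖ ^ 2))).congr_deriv ?_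
    simp only [id_eq]
    ring
  have key := image_le_of_deriv_right_le_deriv_boundary (a := 0) (b := 1)
    (fun s _ => (hφ s).continuousAt.continuousWithinAt) (fun s _ => (hφ s).hasDerivWithinAt)
    (by simp) (fun s _ => (hq s).continuousAt.continuousWithinAt)
    (fun s _ => (hq s).hasDerivWithinAt) (fun s hs => ?_) (Set.right_mem_Icc.2 zero_le_one)
  · simpa using key
  · have hs0 : 0 ≤ s := hs.1
    have hgrad : ‖gradient f (x + s • v) - gradient f x‖ ≤ L * (s * ‖v‖) := by
      simpa [norm_smul, abs_of_nonneg hs0] using hL (x + s • v) x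
    have hinner := (real_inner_le_norm (gradient f (x + s • v) - gradient f x) v).trans
      (mul_le_mul_of_nonneg_right hgrad (norm_nonneg v))
    rw [inner_sub_left] at hinner
    linarith

/-- Theorem 6-b (Type-1 stopping for a given constant step-size): for any constant
step-size `γ > 0` and `κ > 0`, with `ε(κ,γ) = κ + γL/(2cosθ)`, some iterate `x(T)`
satisfies `‖∇f(x(T))‖ ≤ ε(κ,γ)` with `T ≤ ⌈(f(x(0)) - f*)/(cosθ·γ·κ)⌉`. -/
theorem type1_stopping_quantized_given_step {N : ℕ} (hN : 1 ≤ N)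
    (f : EuclideanSpace ℝ (Fin N) → ℝ)
    (hconv : ConvexOn ℝ Set.univ f) (hdiff : Differentiable ℝ f)
    (L : ℝ) (hL : 0 < L)
    (hLip : ∀ x y, ‖gradient f x - gradient f y‖ ≤ L * ‖x - y‖)
    (hXne : {x : EuclideanSpace ℝ (Fin N) | ∀ y, f x ≤ f y}.Nonempty)
    (hXbd : Bornology.IsBounded {x : EuclideanSpace ℝ (Fin N) | ∀ y, f x ≤ f y})
    (fstar : ℝ) (hfstar : IsLeast (Set.range f) fstar)
    (θ : ℝ) (hθ : θ ∈ Set.Ico 0 (π / 2))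
    (D : Finset (EuclideanSpace ℝ (Fin N))) (hD : ∀ d ∈ D, ‖d‖ = 1)
    (hcover : ∀ g : EuclideanSpace ℝ (Fin N), ‖g‖ = 1 → ∃ d ∈ D, Real.cos θ ≤ ⟪g, d⟫)
    (γ κ : ℝ) (hγ : 0 < γ) (hκ : 0 < κ)
    -- the quantized gradient iterates
    (x d : ℕ → EuclideanSpace ℝ (Fin N))
    (hdD : ∀ t, d t ∈ D)
    (hang : ∀ t, Real.cos θ * ‖gradient f (x t)‖ ≤ ⟪gradient f (x t), d t⟫)
    (hiter : ∀ t, x (t + 1) = x t - γ • d t) :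
    ∃ T : ℕ, ‖gradient f (x T)‖ ≤ κ + γ * L / (2 * Real.cos θ) ∧
      T ≤ ⌈(f (x 0) - fstar) / (Real.cos θ * γ * κ)⌉₊ := by
  have hc : 0 < Real.cos θ := Real.cos_pos_of_mem_Ioo ⟨by linarith [Real.pi_pos, hθ.1], hθ.2⟩
  have hδ : 0 < Real.cos θ * γ * κ := by positivity
  by_contra! hlarge
  set K := ⌈(f (x 0) - fstar) / (Real.cos θ * γ * κ)⌉₊
  have hstep (t : ℕ) (ht : t ≤ K) : f (x (t + 1)) ≤ f (x t) - Real.cos θ * γ * κ := by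
    have hnorm : κ + γ * L / (2 * Real.cos θ) < ‖gradient f (x t)‖ :=
      lt_of_not_ge fun h => (hlarge t h).not_ge ht
    have hdesc := le_add_inner_gradient_add_of_lipschitz_gradient hdiff hLip (x t) (-(γ • d t))
    rw [← sub_eq_add_neg, ← hiter, inner_neg_right, real_inner_smul_right, norm_neg, norm_smul,
      hD _ (hdD t), mul_one, Real.norm_eq_abs, sq_abs] at hdesc
    have hdir := mul_le_mul_of_nonneg_left (hang t) hγ.le
    have hbig := mul_le_mul_of_nonneg_left hnorm.le (mul_pos hγ hc).le
    have hexpand : γ * Real.cos θ * (κ + γ * L / (2 * Real.cos θ)) =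
        Real.cos θ * γ * κ + L / 2 * γ ^ 2 := by
      field_simp
    linarith
  have hdecrease (t : ℕ) (ht : t ≤ K + 1) :
      f (x t) ≤ f (x 0) - t * (Real.cos θ * γ * κ) := by
    induction t with
    | zero => simp
    | succ t ih =>
      have := hstep t (by omega)
      have := ih (by omega)
      push_cast
      linarith
  have hfinal := hdecrease (K + 1) le_rfl
  have hmin : fstar ≤ f (x (K + 1)) := hfstar.2 ⟨_, rfl⟩
  have hK := (div_le_iff₀ hδ).1 (Nat.le_ceil ((f (x 0) - fstar) / (Real.cos θ * γ * κ)))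
  push_cast at hfinal
  linarith
end
end

section
/- Fix T ∈ ℕ with T ≥ 1 and suppose f(x(0)) > f*. If the quantized gradient iterates are run with the constant step-size γ* = √( 2(f(x(0)) − f*) / (L T) ), then min_{0 ≤ t ≤ T} ‖∇f(x(t))‖ ≤ √( 2 L (f(x(0)) − f*) ) / ( cos θ · √T ). -/
open Real Filter RealInnerProductSpace

noncomputable section

/-- The descent lemma: a differentiable function with `L`-Lipschitz gradient lies below its
quadratic upper model. -/
theorem le_add_inner_add_sq_of_lipschitz_gradient {F : Type*} [NormedAddCommGroup F]
    [InnerProductSpace ℝ F] [CompleteSpace F] {f : F → ℝ} (hf : Differentiable ℝ f) {L : ℝ}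
    (hLip : ∀ x y, ‖gradient f x - gradient f y‖ ≤ L * ‖x - y‖) (x v : F) :
    f (x + v) ≤ f x + ⟪gradient f x, v⟫ + L / 2 * ‖v‖ ^ 2 := by
  let h : ℝ → ℝ := fun s ↦ f (x + s • v) - s * ⟪gradient f x, v⟫ - s ^ 2 * (L / 2 * ‖v‖ ^ 2)
  have hderiv (s : ℝ) : HasDerivAt h
      (⟪gradient f (x + s • v), v⟫ - ⟪gradient f x, v⟫ - s * (L * ‖v‖ ^ 2)) s := by
    have hline : HasDerivAt (fun s : ℝ ↦ x + s • v) v s := by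
      simpa using ((hasDerivAt_id s).smul_const v).const_add x
    have hcomp : HasDerivAt (fun s : ℝ ↦ f (x + s • v)) ⟪gradient f (x + s • v), v⟫ s := by
      exact (hf (x + s • v)).hasGradientAt.hasFDerivAt.comp_hasDerivAt s hline
    have hlin := (hasDerivAt_id s).mul_const ⟪gradient f x, v⟫
    have hquad := ((hasDerivAt_id s).pow 2).mul_const (L / 2 * ‖v‖ ^ 2)
    refine ((hcomp.sub hlin).sub hquad).congr_deriv ?_
    simp only [id]
    ring
  have hanti : AntitoneOn h (Set.Icc 0 1) := by
    refine antitoneOn_of_deriv_nonpos (convex_Icc 0 1)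
      (fun s _ ↦ (hderiv s).continuousAt.continuousWithinAt)
      (fun s _ ↦ (hderiv s).differentiableAt.differentiableWithinAt) fun s hs ↦ ?_
    rw [interior_Icc] at hs
    rw [(hderiv s).deriv, ← inner_sub_left, sub_nonpos]
    calc ⟪gradient f (x + s • v) - gradient f x, v⟫
        ≤ ‖gradient f (x + s • v) - gradient f x‖ * ‖v‖ := real_inner_le_norm _ _
      _ ≤ L * ‖x + s • v - x‖ * ‖v‖ := by gcongr; exact hLip _ _
      _ = s * (L * ‖v‖ ^ 2) := by
        rw [add_sub_cancel_left, norm_smul, Real.norm_of_nonneg hs.1.le]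
        ring
  have hle : h 1 ≤ h 0 := hanti (by simp) (by simp) zero_le_one
  simp only [h, one_smul, zero_smul, add_zero] at hle
  linarith

/-- Corollary 1 (optimal accuracy in `T` iterations): running the quantized gradient
iterates with the constant step-size `γ* = √(2(f(x(0)) - f*)/(LT))` guarantees
`min_{0 ≤ t ≤ T} ‖∇f(x(t))‖ ≤ √(2L(f(x(0)) - f*))/(cosθ·√T)`. -/
theorem optimal_accuracy_in_T_iterations {N : ℕ} (hN : 1 ≤ N)
    (f : EuclideanSpace ℝ (Fin N) → ℝ)
    (hconv : ConvexOn ℝ Set.univ f) (hdiff : Differentiable ℝ f)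
    (L : ℝ) (hL : 0 < L)
    (hLip : ∀ x y, ‖gradient f x - gradient f y‖ ≤ L * ‖x - y‖)
    (hXne : {x : EuclideanSpace ℝ (Fin N) | ∀ y, f x ≤ f y}.Nonempty)
    (hXbd : Bornology.IsBounded {x : EuclideanSpace ℝ (Fin N) | ∀ y, f x ≤ f y})
    (fstar : ℝ) (hfstar : IsLeast (Set.range f) fstar)
    (θ : ℝ) (hθ : θ ∈ Set.Ico 0 (π / 2))
    (D : Finset (EuclideanSpace ℝ (Fin N))) (hD : ∀ d ∈ D, ‖d‖ = 1)
    (hcover : ∀ g : EuclideanSpace ℝ (Fin N), ‖g‖ = 1 → ∃ d ∈ D, Real.cos θ ≤ ⟪g, d⟫)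
    (T : ℕ) (hT : 1 ≤ T)
    (x₀ : EuclideanSpace ℝ (Fin N)) (hgap : fstar < f x₀)
    (γ : ℝ) (hγ : γ = Real.sqrt (2 * (f x₀ - fstar) / (L * T)))
    -- the quantized gradient iterates started at `x₀`
    (x d : ℕ → EuclideanSpace ℝ (Fin N)) (hx0 : x 0 = x₀)
    (hdD : ∀ t, d t ∈ D)
    (hang : ∀ t, Real.cos θ * ‖gradient f (x t)‖ ≤ ⟪gradient f (x t), d t⟫)
    (hiter : ∀ t, x (t + 1) = x t - γ • d t) :
    ∃ t ≤ T, ‖gradient f (x t)‖ ≤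
      Real.sqrt (2 * L * (f x₀ - fstar)) / (Real.cos θ * Real.sqrt T) := by
  have hcos : 0 < Real.cos θ :=
    Real.cos_pos_of_mem_Ioo ⟨by linarith [hθ.1, Real.pi_pos], hθ.2⟩
  have hTpos : (0 : ℝ) < T := by exact_mod_cast hT
  have hΔ : 0 < f x₀ - fstar := sub_pos.mpr hgap
  set Δ := f x₀ - fstar with hΔdef
  set B := Real.sqrt (2 * L * Δ) / (Real.cos θ * Real.sqrt T) with hB
  have hγpos : 0 < γ := by rw [hγ]; positivity
  have hγsq : L / 2 * γ ^ 2 = Δ / T := by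
    rw [hγ, Real.sq_sqrt (by positivity)]
    field_simp
  have hγB : γ * (Real.cos θ * B) = 2 * (Δ / T) := by
    have hcosB : Real.cos θ * B = Real.sqrt (2 * L * Δ / T) := by
      rw [hB, Real.sqrt_div (by positivity)]
      field_simp
    rw [hcosB, hγ, ← Real.sqrt_mul (by positivity), Real.sqrt_eq_iff_mul_self_eq (by positivity)
      (by positivity)]
    field_simp
  by_contra! hlarge
  have hdescent (t : ℕ) (ht : t ≤ T) : f (x (t + 1)) < f (x t) - Δ / T := by
    have hstep := le_add_inner_add_sq_of_lipschitz_gradient hdiff hLip (x t) (-(γ • d t))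
    rw [← sub_eq_add_neg, ← hiter t, inner_neg_right, real_inner_smul_right, norm_neg, norm_smul,
      hD _ (hdD t), mul_one, Real.norm_of_nonneg hγpos.le, hγsq] at hstep
    have hprogress : γ * (Real.cos θ * B) < γ * ⟪gradient f (x t), d t⟫ := by
      gcongr
      exact (mul_lt_mul_of_pos_left (hlarge t ht) hcos).trans_le (hang t)
    linarith
  have hbound (t : ℕ) (ht : t ≤ T) : f (x t) ≤ f x₀ - t * (Δ / T) := by
    induction t with
    | zero => simp [hx0]
    | succ t ih =>
      push_cast
      linarith [ih (by omega), hdescent t (by omega)]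
  have hlast := hbound T le_rfl
  rw [mul_div_cancel₀ _ hTpos.ne'] at hlast
  linarith [hdescent T le_rfl, hfstar.2 ⟨x (T + 1), rfl⟩, div_pos hΔ hTpos]
end
end

section
/- For every ε > 0 there exist a constant step-size γ > 0 and T ∈ ℕ such that the quantized gradient iterates with γ(t) = γ for all t satisfy f(x(t)) − f* < ε for all t ≥ T. -/
open Real Filter RealInnerProductSpace

noncomputable section

/-- First-order characterization of convexity. -/
theorem ConvexOn.inner_gradient_le_sub {E : Type*} [NormedAddCommGroup E] [InnerProductSpace ℝ E]
    [CompleteSpace E] {f : E → ℝ} (hconv : ConvexOn ℝ Set.univ f) {x : E}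
    (hdiff : DifferentiableAt ℝ f x) (y : E) :
    ⟪gradient f x, y - x⟫ ≤ f y - f x := by
  have hline : ConvexOn ℝ Set.univ (f ∘ AffineMap.lineMap (k := ℝ) x y) :=
    hconv.comp_affineMap (AffineMap.lineMap x y)
  have hderiv : HasDerivAt (f ∘ AffineMap.lineMap (k := ℝ) x y) (fderiv ℝ f x (y - x)) 0 := by
    refine HasFDerivAt.comp_hasDerivAt (0 : ℝ) ?_ AffineMap.hasDerivAt_lineMap
    simpa using hdiff.hasFDerivAt
  have h := hline.le_slope_of_hasDerivAt (Set.mem_univ 0) (Set.mem_univ 1) one_pos hderiv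
  rw [← toDual_gradient, InnerProductSpace.toDual_apply_apply] at h
  simpa [slope_def_field] using h

/-- A convex function on a finite-dimensional space whose set of minimizers is bounded grows at
least linearly away from a minimizer. -/
theorem ConvexOn.exists_linear_growth {E : Type*} [NormedAddCommGroup E] [NormedSpace ℝ E]
    [ProperSpace E] {f : E → ℝ} (hconv : ConvexOn ℝ Set.univ f) (hcont : Continuous f) {z : E}
    (hz : ∀ y, f z ≤ f y) (hbd : Bornology.IsBounded {x | ∀ y, f x ≤ f y}) :
    ∃ R > 0, ∃ m > 0, ∀ x, R ≤ ‖x - z‖ → m * ‖x - z‖ ≤ f x - f z := by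
  obtain ⟨r, hr⟩ := hbd.subset_closedBall z
  have hr0 : 0 ≤ r := by simpa using hr hz
  have hpos : 0 < r + 1 := by linarith
  obtain ⟨m, hm, hmin⟩ : ∃ m > 0, ∀ y ∈ Metric.sphere z (r + 1), m ≤ f y - f z := by
    rcases (Metric.sphere z (r + 1)).eq_empty_or_nonempty with he | hne
    · exact ⟨1, one_pos, by simp [he]⟩
    obtain ⟨w, hw, hwmin⟩ := (isCompact_sphere z (r + 1)).exists_isMinOn hne hcont.continuousOn
    refine ⟨f w - f z, ?_, fun y hy => by linarith [isMinOn_iff.1 hwmin y hy]⟩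
    by_contra! hle
    have hball := hr (show w ∈ {x | ∀ y, f x ≤ f y} from fun y => by linarith [hz y])
    rw [Metric.mem_closedBall] at hball
    rw [Metric.mem_sphere] at hw
    linarith
  refine ⟨r + 1, hpos, m / (r + 1), by positivity, fun x hx => ?_⟩
  have hxpos : 0 < ‖x - z‖ := hpos.trans_le hx
  set a := (r + 1) / ‖x - z‖ with ha
  have ha0 : 0 < a := by positivity
  have ha1 : a ≤ 1 := (div_le_one hxpos).2 hx
  have hmem : (1 - a) • z + a • x ∈ Metric.sphere z (r + 1) := by
    rw [mem_sphere_iff_norm, show (1 - a) • z + a • x - z = a • (x - z) by module, norm_smul,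
      Real.norm_of_nonneg ha0.le, ha, div_mul_cancel₀ _ hxpos.ne']
  have hc := hconv.2 (Set.mem_univ z) (Set.mem_univ x) (sub_nonneg.2 ha1) ha0.le (by ring)
  simp only [smul_eq_mul] at hc
  have hma : m ≤ a * (f x - f z) := by linarith [hmin _ hmem]
  rw [ha, div_mul_eq_mul_div, le_div_iff₀ hxpos] at hma
  rw [div_mul_eq_mul_div, div_le_iff₀ hpos]
  linarith

/-- If the minimizers of a convex function form a bounded set, then points with small gradient
have nearly minimal value. -/
theorem ConvexOn.exists_sub_lt_of_norm_gradient_lt {E : Type*} [NormedAddCommGroup E]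
    [InnerProductSpace ℝ E] [ProperSpace E] {f : E → ℝ}
    (hconv : ConvexOn ℝ Set.univ f) (hdiff : Differentiable ℝ f) {z : E}
    (hz : ∀ y, f z ≤ f y) (hbd : Bornology.IsBounded {x | ∀ y, f x ≤ f y})
    {δ : ℝ} (hδ : 0 < δ) :
    ∃ η > 0, ∀ x, ‖gradient f x‖ < η → f x - f z < δ := by
  obtain ⟨R, hR, m, hm, hgrow⟩ := hconv.exists_linear_growth hdiff.continuous hz hbd
  refine ⟨min m (δ / R), by positivity, fun x hx => ?_⟩
  obtain ⟨hxm, hxδ⟩ := lt_min_iff.1 hx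
  have hle : f x - f z ≤ ‖gradient f x‖ * ‖x - z‖ := by
    have h := hconv.inner_gradient_le_sub (hdiff x) z
    have h' := real_inner_le_norm (gradient f x) (x - z)
    rw [← neg_sub x z, inner_neg_right] at h
    linarith
  have hxR : ‖x - z‖ < R := by
    by_contra! hge
    have hlt := mul_lt_mul_of_pos_right hxm (hR.trans_le hge)
    linarith [hgrow x hge]
  calc f x - f z ≤ ‖gradient f x‖ * ‖x - z‖ := hle
    _ ≤ ‖gradient f x‖ * R := by gcongr
    _ < δ := (lt_div_iff₀ hR).1 hxδ

/-- One step of length `γ` along a unit direction correlated with the gradient. -/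
theorem ConvexOn.sub_smul_le_of_inner_gradient {E : Type*} [NormedAddCommGroup E]
    [InnerProductSpace ℝ E] [CompleteSpace E] {f : E → ℝ}
    (hconv : ConvexOn ℝ Set.univ f) (hdiff : Differentiable ℝ f) {L : ℝ}
    (hLip : ∀ x y, ‖gradient f x - gradient f y‖ ≤ L * ‖x - y‖)
    {γ c : ℝ} (hγ : 0 ≤ γ) {x d : E} (hd : ‖d‖ = 1)
    (hinner : c * ‖gradient f x‖ ≤ ⟪gradient f x, d⟫) :
    f (x - γ • d) ≤ f x - γ * (c * ‖gradient f x‖) + L * γ ^ 2 := by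
  have h := hconv.inner_gradient_le_sub (hdiff (x - γ • d)) x
  rw [sub_sub_cancel, real_inner_smul_right] at h
  have hL := hLip x (x - γ • d)
  rw [sub_sub_cancel, norm_smul, Real.norm_of_nonneg hγ, hd, mul_one] at hL
  have hcs := real_inner_le_norm (gradient f x - gradient f (x - γ • d)) d
  rw [hd, mul_one, inner_sub_left] at hcs
  have hbound : c * ‖gradient f x‖ - L * γ ≤ ⟪gradient f (x - γ • d), d⟫ := by linarith
  have := mul_le_mul_of_nonneg_left hbound hγ
  nlinarith

/-- Theorem 7-a (Type-2 stopping, constant step-size, quantized gradient method):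
for every `ε > 0` there are a constant step-size `γ > 0` and `T ∈ ℕ` such that the
quantized gradient iterates satisfy `f(x(t)) - f* < ε` for all `t ≥ T`. -/
theorem type2_stopping_quantized {N : ℕ} (hN : 1 ≤ N)
    (f : EuclideanSpace ℝ (Fin N) → ℝ)
    (hconv : ConvexOn ℝ Set.univ f) (hdiff : Differentiable ℝ f)
    (L : ℝ) (hL : 0 < L)
    (hLip : ∀ x y, ‖gradient f x - gradient f y‖ ≤ L * ‖x - y‖)
    (hXne : {x : EuclideanSpace ℝ (Fin N) | ∀ y, f x ≤ f y}.Nonempty)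
    (hXbd : Bornology.IsBounded {x : EuclideanSpace ℝ (Fin N) | ∀ y, f x ≤ f y})
    (fstar : ℝ) (hfstar : IsLeast (Set.range f) fstar)
    (θ : ℝ) (hθ : θ ∈ Set.Ico 0 (π / 2))
    (D : Finset (EuclideanSpace ℝ (Fin N))) (hD : ∀ d ∈ D, ‖d‖ = 1)
    (hcover : ∀ g : EuclideanSpace ℝ (Fin N), ‖g‖ = 1 → ∃ d ∈ D, Real.cos θ ≤ ⟪g, d⟫)
    (x₀ : EuclideanSpace ℝ (Fin N))
    (ε : ℝ) (hε : 0 < ε) :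
    ∃ γ : ℝ, 0 < γ ∧ ∃ T : ℕ,
      ∀ x d : ℕ → EuclideanSpace ℝ (Fin N), x 0 = x₀ →
        (∀ t, d t ∈ D) →
        (∀ t, Real.cos θ * ‖gradient f (x t)‖ ≤ ⟪gradient f (x t), d t⟫) →
        (∀ t, x (t + 1) = x t - γ • d t) →
        ∀ t, T ≤ t → f (x t) - fstar < ε := by
  obtain ⟨z, hz⟩ := hXne
  have hzf : f z = fstar := by
    obtain ⟨w, hw⟩ := hfstar.1
    exact le_antisymm (hw ▸ hz w) (hfstar.2 ⟨z, rfl⟩)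
  subst hzf
  have hc : 0 < Real.cos θ := Real.cos_pos_of_mem_Ioo ⟨by linarith [hθ.1, Real.pi_pos], hθ.2⟩
  obtain ⟨η, hη, hsmall⟩ :=
    hconv.exists_sub_lt_of_norm_gradient_lt hdiff hz hXbd (half_pos hε)
  obtain ⟨γ, hγ, hγη, hγε⟩ :
      ∃ γ > 0, L * γ ≤ Real.cos θ * η / 2 ∧ L * γ ^ 2 ≤ ε / 2 := by
    refine ⟨min 1 (min (Real.cos θ * η / 2 / L) (ε / 2 / L)), by positivity, ?_, ?_⟩
    · rw [mul_comm, ← le_div_iff₀ hL]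
      exact (min_le_right _ _).trans (min_le_left _ _)
    · set γ := min 1 (min (Real.cos θ * η / 2 / L) (ε / 2 / L))
      have hγ0 : 0 ≤ γ := by positivity
      rw [mul_comm, ← le_div_iff₀ hL]
      exact (pow_le_of_le_one hγ0 (min_le_left _ _) two_ne_zero).trans
        ((min_le_right _ _).trans (min_le_right _ _))
  have hκ : 0 < γ * (Real.cos θ * η / 2) := by positivity
  set κ := γ * (Real.cos θ * η / 2) with hκ_def
  obtain ⟨T, hT⟩ := exists_nat_gt ((f x₀ - f z) / κ)
  rw [div_lt_iff₀ hκ] at hT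
  refine ⟨γ, hγ, T, fun x d hx0 hdD hinner hstep t ht => ?_⟩
  have key : ∀ t : ℕ, f (x t) - f z < ε ∨ f (x t) - f z ≤ f x₀ - f z - t * κ := by
    intro t
    induction t with
    | zero => right; simp [hx0]
    | succ t ih =>
      have hdesc := hconv.sub_smul_le_of_inner_gradient hdiff hLip hγ.le (hD _ (hdD t)) (hinner t)
      rw [← hstep] at hdesc
      rcases lt_or_ge ‖gradient f (x t)‖ η with hlt | hge
      · left
        have : 0 ≤ γ * (Real.cos θ * ‖gradient f (x t)‖) := by positivity
        linarith [hsmall _ hlt]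
      · have hgrad : γ * (Real.cos θ * η) ≤ γ * (Real.cos θ * ‖gradient f (x t)‖) := by gcongr
        have hdec : f (x (t + 1)) ≤ f (x t) - κ := by
          have := mul_le_mul_of_nonneg_left hγη hγ.le
          nlinarith
        push_cast
        rcases ih with h | h
        · left; linarith
        · right; linarith
  rcases key t with h | h
  · exact h
  · have : (T : ℝ) * κ ≤ t * κ := by gcongr
    linarith
end
end

section
/- Let f : ℝ^N → ℝ be convex and differentiable with L-Lipschitz continuous gradient (L > 0), and suppose its set of minimizers X* is nonempty and bounded. Then there exists κ > 0 such that for every ε < κ the sublevel set of the gradient norm {x ∈ ℝ^N : ‖∇f(x)‖ ≤ ε} is bounded. -/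
/-- A differentiable convex function lies above its tangent hyperplanes. -/
theorem ConvexOn.sub_le_inner_gradient {E : Type*} [NormedAddCommGroup E]
    [InnerProductSpace ℝ E] [CompleteSpace E] {f : E → ℝ} (hf : ConvexOn ℝ Set.univ f) {x : E}
    (hx : DifferentiableAt ℝ f x) (y : E) : f x - f y ≤ inner ℝ (gradient f x) (x - y) := by
  have hline : HasDerivAt (fun t : ℝ => f (AffineMap.lineMap x y t))
      (inner ℝ (gradient f x) (y - x)) 0 := by
    have h := hx.hasGradientAt.hasFDerivAt
    rw [← AffineMap.lineMap_apply_zero (k := ℝ) x y] at h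
    simpa [Function.comp_def] using h.comp_hasDerivAt (0 : ℝ) AffineMap.hasDerivAt_lineMap
  have hconv : ConvexOn ℝ Set.univ (fun t : ℝ => f (AffineMap.lineMap x y t)) :=
    hf.comp_affineMap (AffineMap.lineMap x y)
  have h := hconv.le_slope_of_hasDerivAt (Set.mem_univ 0) (Set.mem_univ 1) one_pos hline
  simp only [slope_def_field, AffineMap.lineMap_apply_one, AffineMap.lineMap_apply_zero, sub_zero,
    div_one] at h
  rw [← neg_sub y x, inner_neg_right]
  linarith

/-- A convex function which exceeds `f x₀` by at least `δ` on the sphere of radius `R` around `x₀`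
grows at least at the rate `δ / R` outside that sphere. -/
theorem ConvexOn.div_mul_norm_le_of_sphere {E : Type*} [NormedAddCommGroup E]
    [NormedSpace ℝ E] {f : E → ℝ} (hf : ConvexOn ℝ Set.univ f) {x₀ : E} {R δ : ℝ} (hR : 0 < R)
    (hδ : ∀ z ∈ Metric.sphere x₀ R, f x₀ + δ ≤ f z) {x : E} (hx : R ≤ ‖x - x₀‖) :
    δ / R * ‖x - x₀‖ ≤ f x - f x₀ := by
  have hpos : 0 < ‖x - x₀‖ := hR.trans_le hx
  set t : ℝ := R / ‖x - x₀‖ with ht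
  have ht0 : 0 < t := by positivity
  have ht1 : t ≤ 1 := (div_le_one hpos).2 hx
  have hsphere : AffineMap.lineMap x₀ x t ∈ Metric.sphere x₀ R := by
    rw [mem_sphere_iff_norm, AffineMap.lineMap_apply, vsub_eq_sub, vadd_eq_add,
      add_sub_cancel_right, norm_smul, Real.norm_of_nonneg ht0.le, ht, div_mul_cancel₀ _ hpos.ne']
  have hle := hf.2 (Set.mem_univ x₀) (Set.mem_univ x) (sub_nonneg.2 ht1) ht0.le
    (sub_add_cancel 1 t)
  rw [← AffineMap.lineMap_apply_module] at hle
  have hmul : δ ≤ t * (f x - f x₀) := by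
    have := hδ _ hsphere
    simp only [smul_eq_mul] at hle
    linarith
  rw [ht, div_mul_eq_mul_div, le_div_iff₀ hpos] at hmul
  rw [div_mul_eq_mul_div, div_le_iff₀ hR]
  linarith

/-- Lemma 10-(i): if the set of minimizers of a convex differentiable `f` with
`L`-Lipschitz gradient is nonempty and bounded, then there is `κ > 0` such that the
gradient-norm sublevel set `{x : ‖∇f(x)‖ ≤ ε}` is bounded for every `ε < κ`. -/
theorem bounded_gradient_sublevel {N : ℕ}
    (f : EuclideanSpace ℝ (Fin N) → ℝ)
    (hconv : ConvexOn ℝ Set.univ f) (hdiff : Differentiable ℝ f)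
    (L : ℝ) (hL : 0 < L)
    (hLip : ∀ x y, ‖gradient f x - gradient f y‖ ≤ L * ‖x - y‖)
    (hXne : {x : EuclideanSpace ℝ (Fin N) | ∀ y, f x ≤ f y}.Nonempty)
    (hXbd : Bornology.IsBounded {x : EuclideanSpace ℝ (Fin N) | ∀ y, f x ≤ f y}) :
    ∃ κ > 0, ∀ ε : ℝ, ε < κ →
      Bornology.IsBounded {x : EuclideanSpace ℝ (Fin N) | ‖gradient f x‖ ≤ ε} := by
  obtain ⟨x₀, hx₀⟩ := hXne
  obtain ⟨R, hR, hsub⟩ := hXbd.subset_ball_lt 0 x₀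
  have hlt : ∀ z ∈ Metric.sphere x₀ R, f x₀ < f z := by
    intro z hz
    by_contra! hle
    have hball : z ∈ Metric.ball x₀ R := hsub fun y => hle.trans (hx₀ y)
    exact (Metric.mem_ball.1 hball).ne hz
  obtain ⟨m, hm, hmin⟩ :=
    (isCompact_sphere x₀ R).exists_forall_le' hdiff.continuous.continuousOn hlt
  refine ⟨(m - f x₀) / R, div_pos (sub_pos.2 hm) hR, fun ε hε => ?_⟩
  refine Metric.isBounded_ball.subset (t := Metric.ball x₀ R) fun x hx => ?_
  rw [mem_ball_iff_norm]
  by_contra! hfar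
  have hgrowth : (m - f x₀) / R * ‖x - x₀‖ ≤ f x - f x₀ :=
    hconv.div_mul_norm_le_of_sphere hR (fun z hz => by linarith [hmin z hz]) hfar
  have hgrad := (hconv.sub_le_inner_gradient (hdiff x) x₀).trans (real_inner_le_norm _ _)
  have hκ := le_of_mul_le_mul_right (hgrowth.trans hgrad) (hR.trans_le hfar)
  exact (hκ.trans hx).not_gt hε
end
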